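/- The assignment (f,φ) ↦ f·φ is a left action of the dual algebra of T: for all ℂ-linear functionals f₁, f₂ on T and every function φ : H → V, (f₁⋆f₂)·φ = f₁·(f₂·φ). -/

import Mathlib

open scoped Classical

noncomputable section

/-- The product of the quantum double `D(H)`:
`(F₁•F₂)(x,y) = Σ_z F₁(x,z)·F₂(z⁻¹xz, z⁻¹y)`. -/
def Dmul {H : Type*} [Group H] [Fintype H] (F₁ F₂ : H × H → ℂ) : H × H → ℂ :=
  fun p => ∑ z : H, F₁ (p.1, z) * F₂ (z⁻¹ * p.1 * z, z⁻¹ * p.2)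

/-- The unit of the quantum double `D(H)`: `1_D(x,y) = δ_{y,e}`. -/
def Done {H : Type*} [Group H] : H × H → ℂ := fun p => if p.2 = 1 then 1 else 0

/-- The coproduct of the quantum double `D(H)`:
`(ΔF)(x₁,y₁;x₂,y₂) = F(x₁x₂,y₁)` if `y₁ = y₂` and `0` otherwise. -/
def Dcomul {H : Type*} [Group H] (F : H × H → ℂ) : (H × H) × (H × H) → ℂ :=
  fun q => if q.1.2 = q.2.2 then F (q.1.1 * q.2.1, q.1.2) else 0

/-- The counit of the quantum double `D(H)`: `ε(F) = Σ_y F(e,y)`. -/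
def Dcounit {H : Type*} [Group H] [Fintype H] (F : H × H → ℂ) : ℂ := ∑ y : H, F (1, y)

/-- The antipode of the quantum double `D(H)`: `(SF)(x,y) = F(y⁻¹x⁻¹y, y⁻¹)`. -/
def Dantipode {H : Type*} [Group H] (F : H × H → ℂ) : H × H → ℂ :=
  fun p => F (p.2⁻¹ * p.1⁻¹ * p.2, p.2⁻¹)

/-- The subspace `T = F(H/K) ⊗ ℂN` of `D(H)` attached to a normal subgroup `K ⊴ H` and a
subgroup `N ≤ H`: functions constant on `K`-cosets in the first argument and supported on
`N` in the second argument. -/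
def Tset {H : Type*} [Group H] (K N : Subgroup H) : Set (H × H → ℂ) :=
  {F | (∀ (x y k : H), k ∈ K → F (x * k, y) = F (x, y)) ∧
       (∀ x y : H, y ∉ N → F (x, y) = 0)}

/-- `T` as a submodule of `D(H)`. -/
def Tsub {H : Type*} [Group H] (K N : Subgroup H) : Submodule ℂ (H × H → ℂ) where
  carrier := Tset K N
  add_mem' := by
    rintro a b ⟨ha1, ha2⟩ ⟨hb1, hb2⟩
    refine ⟨fun x y k hk => ?_, fun x y hy => ?_⟩
    · simp only [Pi.add_apply, ha1 x y k hk, hb1 x y k hk]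
    · simp only [Pi.add_apply, ha2 x y hy, hb2 x y hy, add_zero]
  zero_mem' := ⟨fun x y k hk => rfl, fun x y hy => rfl⟩
  smul_mem' := by
    rintro c a ⟨ha1, ha2⟩
    refine ⟨fun x y k hk => ?_, fun x y hy => ?_⟩
    · simp only [Pi.smul_apply, ha1 x y k hk]
    · simp only [Pi.smul_apply, ha2 x y hy, smul_zero]

/-- The element `u_g ∈ T`: `u_g(x,y) = 1/|K|` if `x ∈ gK` and `y = e`, else `0`
(the projection onto `T` of the delta function at `(g,e)` coming from the first leg of
the `R`-matrix of `D(H)`). -/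
def uElt {H : Type*} [Group H] [Fintype H] (K : Subgroup H) (g : H) : H × H → ℂ :=
  fun p => if g⁻¹ * p.1 ∈ K ∧ p.2 = 1 then 1 / (Nat.card K : ℂ) else 0

/-- `u_g` as an element of the submodule `T`. -/
def uT {H : Type*} [Group H] [Fintype H] (K N : Subgroup H) (g : H) : Tsub K N :=
  ⟨uElt K g, by
    refine ⟨fun x y k hk => ?_, fun x y hy => ?_⟩
    · have h : (g⁻¹ * (x * k) ∈ K ∧ y = 1) ↔ (g⁻¹ * x ∈ K ∧ y = 1) := by
        rw [← mul_assoc]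
        exact and_congr_left' (mul_mem_cancel_right hk)
      simp only [uElt, h]
    · have h : ¬(g⁻¹ * x ∈ K ∧ y = 1) := fun hc => hy (hc.2 ▸ N.one_mem)
      simp only [uElt, if_neg h]⟩

/-- The (left) action `f·φ` of a functional `f` on `T` on a function `φ : H → V`:
`(f·φ)(x) = Σ_g f(u_g)·φ(g⁻¹x)`. -/
def dotAct {H : Type*} [Group H] [Fintype H] (K N : Subgroup H)
    {V : Type*} [AddCommGroup V] [Module ℂ V]
    (f : Tsub K N → ℂ) (φ : H → V) : H → V :=
  fun x => ∑ g : H, f (uT K N g) • φ (g⁻¹ * x)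

/-- For `F ∈ T` and fixed `p₁`, the function `p₂ ↦ (ΔF)(p₁,p₂)` again lies in `T`. -/
theorem innerFun_mem {H : Type*} [Group H] (K N : Subgroup H) (F : H × H → ℂ)
    (hF : F ∈ Tset K N) (p₁ : H × H) :
    (fun p₂ : H × H => Dcomul F (p₁, p₂)) ∈ Tset K N := by
  refine ⟨fun x y k hk => ?_, fun x y hy => ?_⟩
  · simp only [Dcomul]
    by_cases h : p₁.2 = y
    · simp only [h, eq_self_iff_true, if_true, ← mul_assoc]
      exact hF.1 (p₁.1 * x) y k hk
    · simp only [if_neg h]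
  · simp only [Dcomul]
    by_cases h : p₁.2 = y
    · simp only [h, if_pos rfl]
      exact hF.2 _ _ (h ▸ hy)
    · simp only [if_neg h]

/-- For `F ∈ T` and a linear functional `f₂` on `T`, the outer function
`p₁ ↦ f₂(p₂ ↦ (ΔF)(p₁,p₂))` again lies in `T` (here `K` is normal). -/
theorem outerFun_mem {H : Type*} [Group H] (K N : Subgroup H) [hKn : K.Normal]
    (f₂ : Tsub K N →ₗ[ℂ] ℂ) (F : Tsub K N) :
    (fun p₁ : H × H => f₂ ⟨fun p₂ : H × H => Dcomul F.1 (p₁, p₂),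
      innerFun_mem K N F.1 F.2 p₁⟩) ∈ Tset K N := by
  refine ⟨fun x y k hk => ?_, fun x y hy => ?_⟩
  · have he : (⟨fun p₂ : H × H => Dcomul F.1 ((x * k, y), p₂),
        innerFun_mem K N F.1 F.2 (x * k, y)⟩ : Tsub K N) =
        ⟨fun p₂ : H × H => Dcomul F.1 ((x, y), p₂), innerFun_mem K N F.1 F.2 (x, y)⟩ := by
      apply Subtype.ext
      funext p₂
      simp only [Dcomul]
      by_cases h : y = p₂.2
      · simp only [if_pos h]
        have hk' : p₂.1⁻¹ * k * p₂.1 ∈ K := by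
          have := hKn.conj_mem k hk p₂.1⁻¹
          simpa using this
        have : x * k * p₂.1 = x * p₂.1 * (p₂.1⁻¹ * k * p₂.1) := by group
        rw [this, F.2.1 (x * p₂.1) y _ hk']
      · simp only [if_neg h]
    exact congrArg f₂ he
  · have he : (⟨fun p₂ : H × H => Dcomul F.1 ((x, y), p₂),
        innerFun_mem K N F.1 F.2 (x, y)⟩ : Tsub K N) = 0 := by
      apply Subtype.ext
      funext p₂
      simp only [Dcomul]
      by_cases h : y = p₂.2
      · simp only [if_pos h]
        exact F.2.2 _ _ hy
      · simp only [if_neg h]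
        rfl
    have hz : f₂ ⟨fun p₂ : H × H => Dcomul F.1 ((x, y), p₂),
        innerFun_mem K N F.1 F.2 (x, y)⟩ = 0 := by
      rw [he, map_zero]
    exact hz

/-- The convolution `f₁⋆f₂` of two linear functionals on `T`, defined via the coproduct
of `D(H)`. -/
def convDual {H : Type*} [Group H] (K N : Subgroup H) [K.Normal]
    (f₁ f₂ : Tsub K N →ₗ[ℂ] ℂ) : Tsub K N → ℂ :=
  fun F => f₁ ⟨fun p₁ : H × H => f₂ ⟨fun p₂ : H × H => Dcomul F.1 (p₁, p₂),
    innerFun_mem K N F.1 F.2 p₁⟩, outerFun_mem K N f₂ F⟩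

/-- The element `u_g` depends only on the coset of `g` modulo the normal subgroup `K`. -/
theorem uT_mul_left {H : Type*} [Group H] [Fintype H] (K N : Subgroup H) [hKn : K.Normal]
    {k : H} (hk : k ∈ K) (g : H) : uT K N (k * g) = uT K N g := by
  apply Subtype.ext
  funext p
  have hk' : g⁻¹ * k⁻¹ * g ∈ K := by
    simpa using hKn.conj_mem k⁻¹ (K.inv_mem hk) g⁻¹
  have hmul : (k * g)⁻¹ * p.1 = g⁻¹ * k⁻¹ * g * (g⁻¹ * p.1) := by group
  simp only [uT, uElt, hmul, K.mul_mem_cancel_left hk']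

/-- The inner function of the convolution at `u_g`. -/
theorem Dcomul_uElt {H : Type*} [Group H] [Fintype H] (K : Subgroup H) (g : H) (p q : H × H) :
    Dcomul (uElt K g) (p, q) = if p.2 = 1 then uElt K (p.1⁻¹ * g) q else 0 := by
  have hmul : (p.1⁻¹ * g)⁻¹ * q.1 = g⁻¹ * (p.1 * q.1) := by group
  simp only [Dcomul, uElt, hmul]
  grind

/-- A function supported on `H × {e}` and constant on `K`-cosets is a combination of the
elements `u_a`. -/
theorem sum_mul_uElt {H : Type*} [Group H] [Fintype H] (K : Subgroup H) (c : H → ℂ)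
    (hc : ∀ x k : H, k ∈ K → c (x * k) = c x) (p : H × H) :
    ∑ a : H, c a * uElt K a p = if p.2 = 1 then c p.1 else 0 := by
  by_cases hp : p.2 = 1
  · have hcard : (Nat.card K : ℂ) ≠ 0 := Nat.cast_ne_zero.mpr Nat.card_pos.ne'
    have hterm (b : H) : c (p.1 * b) * uElt K (p.1 * b) p =
        if b ∈ K then c p.1 * (1 / (Nat.card K : ℂ)) else 0 := by
      by_cases hb : b ∈ K <;> simp [uElt, hp, hb, hc]
    rw [← Equiv.sum_comp (Equiv.mulLeft p.1)]
    simp only [Equiv.coe_mulLeft, hterm, if_pos hp]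
    rw [← Finset.sum_filter, Finset.sum_const, ← Fintype.card_subtype, nsmul_eq_mul,
      ← Nat.card_eq_fintype_card]
    change (Nat.card K : ℂ) * _ = _
    field_simp
  · simp [uElt, hp]

/-- The convolution of two functionals evaluated at `u_g`. -/
theorem convDual_uT {H : Type*} [Group H] [Fintype H] (K N : Subgroup H) [K.Normal]
    (f₁ f₂ : Tsub K N →ₗ[ℂ] ℂ) (g : H) :
    convDual K N f₁ f₂ (uT K N g) = ∑ a : H, f₁ (uT K N a) * f₂ (uT K N (a⁻¹ * g)) := by
  have hinner (p : H × H) : (⟨fun q => Dcomul (uT K N g).1 (p, q),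
      innerFun_mem K N _ (uT K N g).2 p⟩ : Tsub K N) =
      if p.2 = 1 then uT K N (p.1⁻¹ * g) else 0 := by
    apply Subtype.ext
    funext q
    refine (Dcomul_uElt K g p q).trans ?_
    split_ifs <;> rfl
  have hcoset (x k : H) (hk : k ∈ K) :
      f₂ (uT K N ((x * k)⁻¹ * g)) = f₂ (uT K N (x⁻¹ * g)) := by
    rw [mul_inv_rev, mul_assoc, uT_mul_left K N (K.inv_mem hk)]
  have houter : (⟨fun p => f₂ ⟨fun q => Dcomul (uT K N g).1 (p, q),
      innerFun_mem K N _ (uT K N g).2 p⟩, outerFun_mem K N f₂ (uT K N g)⟩ : Tsub K N) =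
      ∑ a : H, f₂ (uT K N (a⁻¹ * g)) • uT K N a := by
    apply Subtype.ext
    funext p
    have hsum := sum_mul_uElt K (fun a => f₂ (uT K N (a⁻¹ * g))) hcoset p
    simp only [hinner, Submodule.coe_sum, Submodule.coe_smul, Finset.sum_apply, Pi.smul_apply,
      smul_eq_mul, apply_ite f₂, map_zero]
    exact hsum.symm
  rw [convDual, houter, map_sum]
  simp only [map_smul, smul_eq_mul, mul_comm]

/-- the assignment `(f,φ) ↦ f·φ` is a left action of the dual algebra of
`T`: `(f₁⋆f₂)·φ = f₁·(f₂·φ)`. -/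
theorem statement18 {H : Type*} [Group H] [Fintype H] (K N : Subgroup H) [K.Normal]
    {V : Type*} [AddCommGroup V] [Module ℂ V]
    (f₁ f₂ : Tsub K N →ₗ[ℂ] ℂ) (φ : H → V) :
    dotAct K N (convDual K N f₁ f₂) φ = dotAct K N (⇑f₁) (dotAct K N (⇑f₂) φ) := by
  funext x
  simp only [dotAct, convDual_uT, Finset.sum_smul, Finset.smul_sum]
  rw [Finset.sum_comm]
  refine Finset.sum_congr rfl fun a _ => ?_
  rw [← Equiv.sum_comp (Equiv.mulLeft a)]
  refine Finset.sum_congr rfl fun b _ => ?_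
  simp [mul_smul, mul_assoc]
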